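/- Let P be a set of n points in ℝ^d with Δ = diam(P), let ε ∈ (0, 1/2) and ζ > 1 be parameters, and let r be an integer with r ≥ ζ/ε². For a sequence Q = (q_1, …, q_r) ∈ P^r, write c(Q) = (1/r)·∑_{i=1}^r q_i. Then the number of sequences Q ∈ P^r satisfying ‖c(Q) − c(P)‖ > ε·Δ is at most (1/ζ)·n^r. Equivalently, a uniformly random sequence of r points picked independently with replacement from P has average within distance ε·Δ of c(P) with probability at least 1 − 1/ζ. -/

import Mathlib

open Finset
open scoped Classical

/-- The centroid of a finite set of points in `ℝ^d`. -/
noncomputable def centroid {d : ℕ} (P : Finset (EuclideanSpace ℝ (Fin d))) :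
    EuclideanSpace ℝ (Fin d) :=
  (P.card : ℝ)⁻¹ • ∑ p ∈ P, p

/-- Summing over sequences of length `r + 1` by splitting off the first entry. -/
theorem sum_piFinset_const_succ {α M : Type*} [AddCommMonoid M] (P : Finset α) (r : ℕ)
    (F : (Fin (r + 1) → α) → M) :
    ∑ q ∈ Fintype.piFinset (fun _ : Fin (r + 1) => P), F q =
      ∑ p ∈ P, ∑ q ∈ Fintype.piFinset (fun _ : Fin r => P), F (Fin.cons p q) := by
  rw [← Finset.sum_product']
  symm
  refine Finset.sum_bij' (fun x _ => Fin.cons x.1 x.2) (fun q _ => (q 0, Fin.tail q)) ?_ ?_ ?_ ?_ ?_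
  · rintro ⟨p, q⟩ h
    simp only [Finset.mem_product, Fintype.mem_piFinset] at h ⊢
    exact Fin.cases h.1 h.2
  · intro q h
    simp only [Finset.mem_product, Fintype.mem_piFinset] at h ⊢
    exact ⟨h 0, fun i => h i.succ⟩
  · simp
  · simp
  · simp

/-- Second moment bound for sums of independent uniform samples of a centered function. -/
theorem sum_norm_sq_sum_le {α E : Type*} [NormedAddCommGroup E] [InnerProductSpace ℝ E]
    (P : Finset α) (f : α → E) (B : ℝ) (hf : ∑ p ∈ P, f p = 0)
    (hB : ∀ p ∈ P, ‖f p‖ ^ 2 ≤ B) (r : ℕ) :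
    ∑ q ∈ Fintype.piFinset (fun _ : Fin r => P), ‖∑ i, f (q i)‖ ^ 2 ≤
      r * (P.card : ℝ) ^ r * B := by
  induction r with
  | zero => simp
  | succ r ih =>
    rw [sum_piFinset_const_succ]
    set T := Fintype.piFinset (fun _ : Fin r => P)
    have hT : (T.card : ℝ) = (P.card : ℝ) ^ r := by simp [T]
    have hcross : ∑ p ∈ P, ∑ q ∈ T, inner ℝ (f p) (∑ i, f (q i)) = 0 := by
      simp_rw [← inner_sum]
      rw [← sum_inner, hf, inner_zero_left]
    have hsq : ∑ p ∈ P, ‖f p‖ ^ 2 ≤ P.card * B := by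
      simpa using Finset.sum_le_card_nsmul P _ B hB
    simp only [Fin.sum_univ_succ, Fin.cons_zero, Fin.cons_succ, norm_add_sq_real,
      Finset.sum_add_distrib, ← Finset.mul_sum, hcross, Finset.sum_const, nsmul_eq_mul, hT]
    have h1 := mul_le_mul_of_nonneg_left hsq (show (0 : ℝ) ≤ (P.card : ℝ) ^ r by positivity)
    have h2 := mul_le_mul_of_nonneg_left ih (show (0 : ℝ) ≤ (P.card : ℝ) by positivity)
    push_cast
    rw [pow_succ]
    linarith

theorem sum_sub_centroid {d : ℕ} {P : Finset (EuclideanSpace ℝ (Fin d))} (hP : P.Nonempty) :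
    ∑ p ∈ P, (p - centroid P) = 0 := by
  have : (P.card : ℝ) ≠ 0 := by exact_mod_cast hP.card_pos.ne'
  rw [Finset.sum_sub_distrib, Finset.sum_const, ← Nat.cast_smul_eq_nsmul ℝ, _root_.centroid,
    smul_inv_smul₀ this, sub_self]

theorem norm_sub_centroid_le_diam {d : ℕ} {P : Finset (EuclideanSpace ℝ (Fin d))}
    {p : EuclideanSpace ℝ (Fin d)} (hp : p ∈ P) :
    ‖p - centroid P‖ ≤ Metric.diam (P : Set (EuclideanSpace ℝ (Fin d))) := by
  have hpos : (0 : ℝ) < P.card := by exact_mod_cast Finset.card_pos.mpr ⟨p, hp⟩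
  have hsum : (P.card : ℝ) • (p - centroid P) = ∑ q ∈ P, (p - q) := by
    rw [Finset.sum_sub_distrib, Finset.sum_const, ← Nat.cast_smul_eq_nsmul ℝ, smul_sub, _root_.centroid,
      smul_inv_smul₀ hpos.ne']
  refine le_of_mul_le_mul_left ?_ hpos
  calc (P.card : ℝ) * ‖p - centroid P‖ = ‖∑ q ∈ P, (p - q)‖ := by
        rw [← hsum, norm_smul, Real.norm_natCast]
    _ ≤ P.card • Metric.diam (P : Set (EuclideanSpace ℝ (Fin d))) := by
        refine (norm_sum_le _ _).trans (Finset.sum_le_card_nsmul _ _ _ fun q hq => ?_)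
        rw [← dist_eq_norm]
        exact Metric.dist_le_diam_of_mem P.finite_toSet.isBounded hp hq
    _ = _ := nsmul_eq_mul _ _

/-- Mean sampling with replacement: for `r ≥ ζ/ε²`, the number of sequences
`Q ∈ P^r` whose average lies at distance more than `ε · diam(P)` from `c(P)` is at most
`(1/ζ) · n^r`. -/
theorem card_bad_sequences_le {d : ℕ} (P : Finset (EuclideanSpace ℝ (Fin d)))
    (n r : ℕ) (ε ζ Δ : ℝ) (hn : P.card = n)
    (hΔ : Δ = Metric.diam (P : Set (EuclideanSpace ℝ (Fin d))))
    (hε : 0 < ε ∧ ε < 1 / 2) (hζ : 1 < ζ) (hr : ζ / ε ^ 2 ≤ (r : ℝ)) :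
    (((Fintype.piFinset (fun _ : Fin r => P)).filter
        (fun q => ε * Δ < ‖((r : ℝ)⁻¹ • ∑ i : Fin r, q i) - centroid P‖)).card : ℝ) ≤
      (1 / ζ) * (n : ℝ) ^ r := by
  subst hn
  obtain ⟨hε, -⟩ := hε
  have hζ0 : 0 < ζ := by linarith
  have hr0 : (0 : ℝ) < r := lt_of_lt_of_le (by positivity) hr
  have hΔ0 : 0 ≤ Δ := hΔ ▸ Metric.diam_nonneg
  set T := Fintype.piFinset (fun _ : Fin r => P)
  set bad := T.filter (fun q => ε * Δ < ‖((r : ℝ)⁻¹ • ∑ i : Fin r, q i) - centroid P‖)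
  rcases bad.eq_empty_or_nonempty with hbad | ⟨q₀, hq₀⟩
  · rw [hbad]
    simp only [Finset.card_empty, Nat.cast_zero]
    positivity
  have hq₀T := (Finset.mem_filter.mp hq₀).1
  have hP : P.Nonempty :=
    ⟨q₀ ⟨0, by exact_mod_cast hr0⟩, Fintype.mem_piFinset.mp hq₀T _⟩
  have hmean (q : Fin r → EuclideanSpace ℝ (Fin d)) :
      ∑ i, (q i - centroid P) = (r : ℝ) • (((r : ℝ)⁻¹ • ∑ i, q i) - centroid P) := by
    rw [Finset.sum_sub_distrib, smul_sub, smul_inv_smul₀ hr0.ne', Nat.cast_smul_eq_nsmul ℝ]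
    simp
  have hle : ∀ p ∈ P, ‖p - centroid P‖ ≤ Δ := fun p hp => hΔ ▸ norm_sub_centroid_le_diam hp
  have hΔpos : 0 < Δ := by
    refine hΔ0.lt_of_ne' fun h => ?_
    have hzero : ∑ i, (q₀ i - centroid P) = 0 := Finset.sum_eq_zero fun i _ =>
      norm_le_zero_iff.mp (h ▸ hle _ (Fintype.mem_piFinset.mp hq₀T i))
    have hlt := (Finset.mem_filter.mp hq₀).2
    rw [hmean, smul_eq_zero_iff_right hr0.ne'] at hzero
    simp [hzero, h] at hlt
  have hmoment := sum_norm_sq_sum_le P (fun p => p - centroid P) (Δ ^ 2) (sum_sub_centroid hP)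
    (fun p hp => pow_le_pow_left₀ (norm_nonneg _) (hle p hp) 2) r
  have hmarkov : bad.card * (r * (ε * Δ)) ^ 2 ≤ r * (P.card : ℝ) ^ r * Δ ^ 2 := by
    refine le_trans ?_ hmoment
    rw [← nsmul_eq_mul]
    refine (Finset.card_nsmul_le_sum bad (fun q => ‖∑ i, (q i - centroid P)‖ ^ 2) _
      fun q hq => ?_).trans
        (Finset.sum_le_sum_of_subset_of_nonneg (Finset.filter_subset _ _) fun _ _ _ => by positivity)
    rw [hmean, norm_smul, Real.norm_natCast]
    gcongr
    exact (Finset.mem_filter.mp hq).2.le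
  have hcount : bad.card * (r * ε ^ 2) ≤ (P.card : ℝ) ^ r := by
    refine le_of_mul_le_mul_left ?_ (show 0 < r * Δ ^ 2 by positivity)
    linarith
  rw [div_le_iff₀ (by positivity)] at hr
  rw [one_div, ← div_eq_inv_mul, le_div_iff₀ hζ0]
  exact (mul_le_mul_of_nonneg_left hr (Nat.cast_nonneg _)).trans hcount
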